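/- Let D = (V, E, w) be a vertex-weighted rooted forest (a disjoint union of rooted trees, i.e. oriented trees in which all edges are oriented away from the root) such that w(x) ≥ 2 for every vertex x whose degree in the underlying graph is not 1. Then for every integer t ≥ 1, the projective dimension of the S-module S/I(D)^t equals |E|, the number of edges of D; in particular pd(S/I(D)^t) is independent of t. -/

import Mathlib

open MvPolynomial

universe u v

/-- `HasProjDimLE R n M` : the `R`-module `M` admits a projective resolution of length `≤ n`. -/
def HasProjDimLE (R : Type u) [Ring R] :
    ℕ → ∀ (M : Type v) [AddCommGroup M] [Module R M], Prop
  | 0, M, _, _ => Module.Projective R M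
  | n + 1, M, _, _ =>
      ∃ (P : Type v) (_ : AddCommGroup P) (_ : Module R P) (f : P →ₗ[R] M),
        Module.Projective R P ∧ Function.Surjective f ∧
          HasProjDimLE R n (LinearMap.ker f)

/-- The projective dimension of an `R`-module `M`: the minimal length of a projective
resolution of `M` (`⊤` if there is no finite projective resolution). -/
noncomputable def projDim (R : Type u) [Ring R] (M : Type v) [AddCommGroup M]
    [Module R M] : ℕ∞ :=
  sInf {n : ℕ∞ | ∃ m : ℕ, (m : ℕ∞) = n ∧ HasProjDimLE R m M}

/-- The edge ideal of a vertex-weighted oriented graph with edge set `E` and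
weight function `w`. -/
noncomputable def edgeIdeal (k : Type*) [Field k] {V : Type*} (E : Finset (V × V))
    (w : V → ℕ) : Ideal (MvPolynomial V k) :=
  Ideal.span ((fun e : V × V => X e.1 * X e.2 ^ w e.2) '' (E : Set (V × V)))

open CategoryTheory Abelian in
/-- Over a ring `R`, `HasProjDimLE` follows from the vanishing of higher `Ext` groups. -/
lemma HasProjDimLE.of_hasProjectiveDimensionLE {R : Type u} [Ring R] (n : ℕ) (M : Type u)
    [AddCommGroup M] [Module R M] (h : HasProjectiveDimensionLE (ModuleCat.of R M) n) :
    HasProjDimLE R n M := by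
  induction n generalizing M with
  | zero =>
    rw [← projective_iff_hasProjectiveDimensionLE_zero, ← IsProjective.iff_projective] at h
    exact h
  | succ n ih =>
    have hf : Function.Surjective (Finsupp.linearCombination R (id : M → M)) :=
      Finsupp.linearCombination_id_surjective R M
    have hP : Module.Projective R (M →₀ R) := inferInstance
    refine ⟨M →₀ R, inferInstance, inferInstance, _, hP, hf, ih _ ?_⟩
    have hS := LinearMap.shortExact_shortComplexKer hf
    rw [IsProjective.iff_projective] at hP
    exact (hS.hasProjectiveDimensionLT_X₃_iff n hP).1 h

open RingTheory.Sequence in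
lemma IsWeaklyRegular.of_flat_module {R : Type*} [CommRing R] (M : Type*)
    [AddCommGroup M] [Module R M] [Module.Flat R M] {rs : List R} (h : IsWeaklyRegular R rs) :
    IsWeaklyRegular M rs :=
  ((TensorProduct.rid R M).isWeaklyRegular_congr rs).1 (h.isWeaklyRegular_lTensor (M₂ := M))

open CategoryTheory Abelian RingTheory.Sequence in
/-- If every member of a weakly `N`-regular sequence of length `m` kills `L`, then
`Ext^i(L, N) = 0` for `i < m`. -/
lemma ext_eq_zero_of_isWeaklyRegular {R : Type u} [CommRing R] (L : ModuleCat.{u} R)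
    (rs : List R) (hL : ∀ r ∈ rs, ∀ x : L, r • x = 0) (N : ModuleCat.{u} R)
    (hN : IsWeaklyRegular N rs) (i : ℕ) (hi : i < rs.length) (e : Ext L N i) : e = 0 := by
  induction rs generalizing N i with
  | nil => simp at hi
  | cons r rs ih =>
    rw [isWeaklyRegular_cons_iff] at hN
    have hS := hN.1.smulShortComplex_shortExact
    have hr : r • e = 0 := by
      have h1 : r • 𝟙 L = 0 := by
        ext x
        exact hL r (by simp) x
      have h2 : r • e = (r • Ext.mk₀ (𝟙 L)).comp e (zero_add i) := by
        rw [Ext.smul_comp, Ext.mk₀_id_comp]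
      rw [h2, ← Ext.mk₀_smul, h1, Ext.mk₀_zero, Ext.zero_comp]
    have he : e.comp (Ext.mk₀ (ModuleCat.smulShortComplex N r).f) (add_zero i) = 0 := by
      rw [ModuleCat.smulShortComplex_f_eq_smul_id]
      exact (Ext.smul_eq_comp_mk₀ e r).symm.trans hr
    cases i with
    | zero =>
      have := hS.mono_f
      exact Ext.postcomp_mk₀_injective_of_mono L (ModuleCat.smulShortComplex N r).f
        (he.trans (map_zero _).symm)
    | succ i =>
      obtain ⟨y, rfl⟩ := Ext.covariant_sequence_exact₁ L hS e he rfl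
      have hy : y = 0 := ih (fun s hs => hL s (by simp [hs])) _ hN.2 i (by simpa using hi) y
      rw [hy, Ext.zero_comp]
      rfl

open CategoryTheory Abelian RingTheory.Sequence in
lemma HasProjDimLE.ext_eq_zero {R : Type u} [CommRing R] (L : ModuleCat.{u} R)
    (rs : List R) (hrs : IsWeaklyRegular R rs) (hL : ∀ r ∈ rs, ∀ x : L, r • x = 0)
    (j : ℕ) (M : Type u) [AddCommGroup M] [Module R M] (h : HasProjDimLE R j M)
    (i : ℕ) (hi : i + j < rs.length) (e : Ext L (ModuleCat.of R M) i) : e = 0 := by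
  induction j generalizing M i with
  | zero =>
    have : Module.Projective R M := h
    exact ext_eq_zero_of_isWeaklyRegular L rs hL _ (IsWeaklyRegular.of_flat_module M hrs) i hi e
  | succ j ih =>
    obtain ⟨P, _, _, f, hP, hf, hK⟩ := h
    have hS := LinearMap.shortExact_shortComplexKer hf
    obtain ⟨y, hy⟩ := Ext.covariant_sequence_exact₃ L hS e rfl (ih _ hK (i + 1) (by omega) _)
    have hy0 : y = 0 := ext_eq_zero_of_isWeaklyRegular L rs hL _
      (IsWeaklyRegular.of_flat_module P hrs) i (by omega) y
    rw [← hy, hy0, Ext.zero_comp]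

open CategoryTheory Abelian RingTheory.Sequence in
/-- A nonzero element killed by a weakly `R`-regular sequence bounds the length of projective
resolutions from below. -/
lemma HasProjDimLE.length_le {R : Type u} [CommRing R] {rs : List R}
    (hrs : IsWeaklyRegular R rs) {j : ℕ} {M : Type u} [AddCommGroup M] [Module R M]
    (h : HasProjDimLE R j M) {m : M} (hm : m ≠ 0) (hk : ∀ r ∈ rs, r • m = 0) :
    rs.length ≤ j := by
  by_contra! hlt
  have hle : Ideal.ofList rs ≤ LinearMap.ker (LinearMap.toSpanSingleton R M m) :=
    Ideal.span_le.2 fun r hr => by simpa using hk r hr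
  let g : ModuleCat.of R (R ⧸ Ideal.ofList rs) ⟶ ModuleCat.of R M :=
    ModuleCat.ofHom ((Ideal.ofList rs).liftQ _ hle)
  have hg := h.ext_eq_zero (ModuleCat.of R (R ⧸ Ideal.ofList rs)) rs hrs (fun r hr x => by
    obtain ⟨x, rfl⟩ := Ideal.Quotient.mk_surjective x
    refine Ideal.Quotient.eq_zero_iff_mem.2 (Ideal.mul_mem_right _ _ (Ideal.subset_span hr)))
    j M 0 (by omega) (Ext.mk₀ g)
  rw [Ext.mk₀_eq_zero_iff] at hg
  apply hm
  have := congrArg (fun φ => φ.hom (Ideal.Quotient.mk _ 1)) hg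
  have hg1 : LinearMap.toSpanSingleton R M m 1 = 0 := this
  simpa using hg1

open RingTheory.Sequence in
lemma isWeaklyRegular_map_X (k : Type*) [Field k] {σ : Type*} {l : List σ} (hl : l.Nodup) :
    IsWeaklyRegular (MvPolynomial σ k) (l.map (X : σ → MvPolynomial σ k)) := by
  refine ⟨fun i h => ?_⟩
  have hi : i < l.length := by simpa using h
  rw [isSMulRegular_quotient_iff_mem_of_smul_mem]
  intro p hp
  have hJ : (Ideal.ofList ((l.map (X : σ → MvPolynomial σ k)).take i) • ⊤ :
      Submodule (MvPolynomial σ k) (MvPolynomial σ k)) =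
      Ideal.span (X '' {v | v ∈ l.take i}) := by
    rw [smul_eq_mul, Ideal.mul_top, ← List.map_take]
    refine congrArg Ideal.span (Set.ext fun q => ?_)
    exact List.mem_map
  rw [hJ, mem_ideal_span_X_image] at hp ⊢
  intro m hm
  obtain ⟨v, hv, hv0⟩ := hp (Finsupp.single l[i] 1 + m) (by
    simpa [mem_support_iff, X, coeff_monomial_mul] using hm)
  refine ⟨v, hv, ?_⟩
  have hne : l[i] ≠ v := by
    rintro rfl
    obtain ⟨j, hj, hji⟩ := List.mem_take_iff_getElem.1 hv
    have := (List.Nodup.getElem_inj_iff hl).1 hji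
    omega
  simpa [Finsupp.single_apply, hne] using hv0

/-- The ideal generated by the monomials with exponents in `A`. -/
noncomputable def monIdeal (k : Type*) [Field k] {σ : Type*} (A : Set (σ →₀ ℕ)) :
    Ideal (MvPolynomial σ k) :=
  Ideal.span ((fun s => monomial s (1 : k)) '' A)

section monIdeal

variable {k : Type*} [Field k] {σ : Type*}

lemma mem_monIdeal {A : Set (σ →₀ ℕ)} {p : MvPolynomial σ k} :
    p ∈ monIdeal k A ↔ ∀ ξ ∈ p.support, ∃ a ∈ A, a ≤ ξ :=
  mem_ideal_span_monomial_image

lemma monomial_mem_monIdeal {A : Set (σ →₀ ℕ)} {m : σ →₀ ℕ} :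
    monomial m (1 : k) ∈ monIdeal k A ↔ ∃ a ∈ A, a ≤ m := by
  classical
  simp [mem_monIdeal, support_monomial]

lemma monIdeal_mono {A B : Set (σ →₀ ℕ)} (h : ∀ a ∈ A, ∃ b ∈ B, b ≤ a) :
    monIdeal k A ≤ monIdeal k B := by
  refine Ideal.span_le.2 ?_
  rintro _ ⟨a, ha, rfl⟩
  exact monomial_mem_monIdeal.2 (h a ha)

lemma monomial_mul_mem_monIdeal {A : Set (σ →₀ ℕ)} {m : σ →₀ ℕ} {p : MvPolynomial σ k} :
    monomial m 1 * p ∈ monIdeal k A ↔ p ∈ monIdeal k ((fun a => a - m) '' A) := by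
  simp only [mem_monIdeal, mem_support_iff]
  constructor
  · intro h ξ hξ
    obtain ⟨a, ha, hle⟩ := h (m + ξ) (by simpa [coeff_monomial_mul] using hξ)
    exact ⟨a - m, ⟨a, ha, rfl⟩, tsub_le_iff_left.2 hle⟩
  · intro h ξ hξ
    rw [coeff_monomial_mul'] at hξ
    split_ifs at hξ with hm
    · obtain ⟨_, ⟨a, ha, rfl⟩, hle⟩ := h (ξ - m) (by simpa using hξ)
      refine ⟨a, ha, ?_⟩
      have := tsub_le_iff_left.1 hle
      rwa [add_tsub_cancel_of_le hm] at this
    · exact absurd rfl hξ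

lemma monIdeal_insert (a : σ →₀ ℕ) (A : Set (σ →₀ ℕ)) :
    monIdeal k (insert a A) = monIdeal k A ⊔ Ideal.span {monomial a 1} := by
  rw [monIdeal, Set.image_insert_eq, Ideal.span_insert, sup_comm, monIdeal]

lemma monIdeal_mul (A B : Set (σ →₀ ℕ)) :
    monIdeal k A * monIdeal k B = monIdeal k (Set.image2 (· + ·) A B) := by
  rw [monIdeal, monIdeal, Ideal.span_mul_span', monIdeal, ← Set.image2_mul,
    Set.image2_image_left, Set.image2_image_right, Set.image_image2]
  simp [monomial_mul]

end monIdeal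

open CategoryTheory in
/-- Adding one generator to an ideal: the projective dimension of the new quotient is controlled by
the colon ideal `K = (J : m)`. -/
lemma hasProjectiveDimensionLT_quotient_sup_span {R : Type u} [CommRing R] {n : ℕ}
    {J K : Ideal R} {m : R} (hK : ∀ p, m * p ∈ J ↔ p ∈ K)
    (h₁ : HasProjectiveDimensionLT (ModuleCat.of R (R ⧸ K)) n)
    (h₂ : HasProjectiveDimensionLT (ModuleCat.of R (R ⧸ J)) (n + 1)) :
    HasProjectiveDimensionLT (ModuleCat.of R (R ⧸ (J ⊔ Ideal.span {m}))) (n + 1) := by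
  let f : (R ⧸ K) →ₗ[R] (R ⧸ J) := K.mapQ J (LinearMap.mulLeft R m) fun p hp => (hK p).2 hp
  let g : (R ⧸ J) →ₗ[R] (R ⧸ (J ⊔ Ideal.span {m})) := Submodule.factor le_sup_left
  have hinj : Function.Injective f := by
    rw [← LinearMap.ker_eq_bot, LinearMap.ker_eq_bot']
    intro x hx
    obtain ⟨p, rfl⟩ := Submodule.Quotient.mk_surjective K x
    have hx' : (Submodule.Quotient.mk (m * p) : R ⧸ J) = 0 := hx
    rw [Submodule.Quotient.mk_eq_zero] at hx' ⊢
    exact (hK p).1 hx'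
  have hsurj : Function.Surjective g := Submodule.factor_surjective le_sup_left
  have hexact : Function.Exact f g := by
    intro x
    obtain ⟨q, rfl⟩ := Submodule.Quotient.mk_surjective J x
    have hg : g (Submodule.Quotient.mk q) = Submodule.Quotient.mk q := rfl
    rw [hg, Submodule.Quotient.mk_eq_zero]
    constructor
    · intro hq
      obtain ⟨j, hj, y, hy, rfl⟩ := Submodule.mem_sup.1 hq
      obtain ⟨r, rfl⟩ := Ideal.mem_span_singleton.1 hy
      refine ⟨Submodule.Quotient.mk r, ?_⟩
      have : f (Submodule.Quotient.mk r) = Submodule.Quotient.mk (m * r) := rfl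
      rw [this, eq_comm, Submodule.Quotient.eq]
      simpa using hj
    · rintro ⟨y, hy⟩
      obtain ⟨r, rfl⟩ := Submodule.Quotient.mk_surjective K y
      have hfr : f (Submodule.Quotient.mk r) = Submodule.Quotient.mk (m * r) := rfl
      rw [hfr, eq_comm, Submodule.Quotient.eq] at hy
      have hq : q = (q - m * r) + m * r := by ring
      rw [hq]
      exact Submodule.add_mem_sup hy (Ideal.mem_span_singleton.2 (dvd_mul_right m r))
  have hS := ModuleCat.shortComplex_shortExact
    (ModuleCat.shortComplexOfCompEqZero f g hexact.linearMap_comp_eq_zero) hexact hinj hsurj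
  exact hS.hasProjectiveDimensionLT_X₃ n h₁ h₂

open CategoryTheory in
lemma hasProjectiveDimensionLE_quotient_bot (R : Type u) [CommRing R] (n : ℕ) :
    HasProjectiveDimensionLE (ModuleCat.of R (R ⧸ (⊥ : Ideal R))) n := by
  have hP : Module.Projective R (R ⧸ (⊥ : Ideal R)) :=
    Module.Projective.of_equiv (Submodule.quotEquivOfEqBot (⊥ : Ideal R) rfl).symm
  rw [IsProjective.iff_projective] at hP
  have h := (projective_iff_hasProjectiveDimensionLE_zero _).1 hP
  exact hasProjectiveDimensionLT_of_ge _ (0 + 1) (n + 1) (by omega)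

section

variable {k : Type u} [Field k] {σ : Type u}

open CategoryTheory in
/-- The quotient by an ideal with `n` monomial generators has projective dimension at most `n`. -/
lemma hasProjectiveDimensionLE_quotient_monIdeal_card (n : ℕ) (A : Finset (σ →₀ ℕ))
    (hA : A.card ≤ n) :
    HasProjectiveDimensionLE
      (ModuleCat.of (MvPolynomial σ k) (MvPolynomial σ k ⧸ monIdeal k (A : Set (σ →₀ ℕ)))) n := by
  classical
  induction n generalizing A with
  | zero =>
    obtain rfl : A = ∅ := Finset.card_eq_zero.1 (by omega)
    have : monIdeal k ((∅ : Finset (σ →₀ ℕ)) : Set (σ →₀ ℕ)) = ⊥ := by simp [monIdeal]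
    rw [this]
    exact hasProjectiveDimensionLE_quotient_bot _ _
  | succ n ih =>
    obtain rfl | ⟨a, ha⟩ := A.eq_empty_or_nonempty
    · have : monIdeal k ((∅ : Finset (σ →₀ ℕ)) : Set (σ →₀ ℕ)) = ⊥ := by simp [monIdeal]
      rw [this]
      exact hasProjectiveDimensionLE_quotient_bot _ _
    · have hcard : (A.erase a).card ≤ n := by
        rw [Finset.card_erase_of_mem ha]
        omega
      have h := ih _ hcard
      rw [← Finset.insert_erase ha, Finset.coe_insert, monIdeal_insert]
      refine hasProjectiveDimensionLT_quotient_sup_span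
        (K := monIdeal k (((A.erase a).image fun b => b - a : Finset (σ →₀ ℕ)) : Set (σ →₀ ℕ)))
        (fun p => ?_) (ih _ (Finset.card_image_le.trans hcard)) ?_
      · rw [monomial_mul_mem_monIdeal, Finset.coe_image]
      · exact hasProjectiveDimensionLT_of_ge _ (n + 1) (n + 1 + 1) (by omega)

open CategoryTheory in
/-- A family of monomials, added in decreasing order of the index, such that every successive colon
ideal is generated by at most `n` monomials. -/
lemma hasProjectiveDimensionLE_quotient_monIdeal_image {α : Type*} [LinearOrder α] (n : ℕ)
    (L : α → σ →₀ ℕ) (T : Finset α)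
    (hT : ∀ a ∈ T, ∃ C : Finset (σ →₀ ℕ), C.card ≤ n ∧
      monIdeal k ((fun b => L b - L a) '' {b | b ∈ T ∧ a < b}) = monIdeal k (C : Set (σ →₀ ℕ))) :
    HasProjectiveDimensionLE
      (ModuleCat.of (MvPolynomial σ k) (MvPolynomial σ k ⧸ monIdeal k (L '' (T : Set α))))
      (n + 1) := by
  classical
  induction T using Finset.induction_on_min with
  | empty =>
    have : monIdeal k (L '' ((∅ : Finset α) : Set α)) = ⊥ := by simp [monIdeal]
    rw [this]
    exact hasProjectiveDimensionLE_quotient_bot _ _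
  | insert a s has ih =>
    have hset : ∀ x ∈ insert a s, {b | b ∈ insert a s ∧ x < b} = {b | b ∈ s ∧ x < b} := by
      intro x hx
      ext b
      simp only [Finset.mem_insert, Set.mem_ofPred_eq]
      refine ⟨?_, fun h => ⟨Or.inr h.1, h.2⟩⟩
      rintro ⟨rfl | hb, hxb⟩
      · rcases Finset.mem_insert.1 hx with rfl | hx
        · exact absurd hxb (lt_irrefl _)
        · exact absurd hxb (has x hx).asymm
      · exact ⟨hb, hxb⟩
    have hs := ih fun x hx => by
      have := hT x (Finset.mem_insert_of_mem hx)
      rwa [hset x (Finset.mem_insert_of_mem hx)] at this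
    obtain ⟨C, hC, hCeq⟩ := hT a (Finset.mem_insert_self a s)
    have ha : {b | b ∈ insert a s ∧ a < b} = (s : Set α) := by
      rw [hset a (Finset.mem_insert_self a s)]
      ext b
      exact ⟨fun h => h.1, fun h => ⟨h, has b h⟩⟩
    rw [Finset.coe_insert, Set.image_insert_eq, monIdeal_insert]
    refine hasProjectiveDimensionLT_quotient_sup_span (K := monIdeal k (C : Set (σ →₀ ℕ)))
      (fun p => ?_) (hasProjectiveDimensionLE_quotient_monIdeal_card n C hC) hs
    rw [monomial_mul_mem_monIdeal, Set.image_image, ← hCeq, ha]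

end

section edgeExp

variable {σ : Type*} {n : ℕ} (p c : Fin n → σ) (W : Fin n → ℕ)

/-- The exponent of the generator `x_{p i} * x_{c i} ^ W i`. -/
noncomputable def edgeExp (i : Fin n) : σ →₀ ℕ :=
  Finsupp.single (p i) 1 + Finsupp.single (c i) (W i)

/-- The exponent of the product `∏ i, (x_{p i} * x_{c i} ^ W i) ^ a i`. -/
noncomputable def powExp (a : Fin n → ℕ) : σ →₀ ℕ :=
  ∑ i, a i • edgeExp p c W i

lemma edgeExp_apply [DecidableEq σ] (i : Fin n) (v : σ) :
    edgeExp p c W i v = (if p i = v then 1 else 0) + (if c i = v then W i else 0) := by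
  simp [edgeExp, Finsupp.single_apply]

lemma powExp_apply (a : Fin n → ℕ) (v : σ) :
    powExp p c W a v = ∑ i, a i * edgeExp p c W i v := by
  simp [powExp, Finsupp.finsetSum_apply]

lemma powExp_add (a b : Fin n → ℕ) :
    powExp p c W (a + b) = powExp p c W a + powExp p c W b := by
  simp [powExp, add_smul, Finset.sum_add_distrib]

lemma powExp_single (i : Fin n) : powExp p c W (Pi.single i 1) = edgeExp p c W i := by
  simp [powExp, Pi.single_apply]

lemma monIdeal_range_edgeExp_pow (k : Type*) [Field k] (t : ℕ) :
    monIdeal k (Set.range (edgeExp p c W)) ^ t =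
      monIdeal k (powExp p c W '' {a | ∑ i, a i = t}) := by
  induction t with
  | zero =>
    have : {a : Fin n → ℕ | ∑ i, a i = 0} = {0} := by
      ext a
      simp [Finset.sum_eq_zero_iff, funext_iff]
    rw [this, pow_zero, Set.image_singleton, monIdeal, Set.image_singleton]
    simp [powExp]
  | succ t ih =>
    rw [pow_succ, ih, monIdeal_mul]
    congr 1
    ext ξ
    constructor
    · rintro ⟨_, ⟨a, ha, rfl⟩, _, ⟨i, rfl⟩, rfl⟩
      refine ⟨a + Pi.single i 1, ?_, by rw [powExp_add, powExp_single]⟩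
      have ha' : ∑ i, a i = t := ha
      simp [Finset.sum_add_distrib, ha']
    · rintro ⟨a, ha, rfl⟩
      have ha' : ∑ i, a i = t + 1 := ha
      obtain ⟨i, hi⟩ : ∃ i, a i ≠ 0 := by
        by_contra! h
        simp [h] at ha'
      have hle : Pi.single i 1 ≤ a := by
        intro j
        rcases eq_or_ne j i with rfl | hj
        · simpa using Nat.one_le_iff_ne_zero.2 hi
        · simp [hj]
      obtain ⟨b, rfl⟩ := exists_add_of_le hle
      refine ⟨_, ⟨b, ?_, rfl⟩, _, ⟨i, rfl⟩, ?_⟩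
      · simp only [Pi.add_apply, Finset.sum_add_distrib, Finset.sum_pi_single', Finset.mem_univ,
          if_true] at ha'
        change ∑ i, b i = t
        omega
      · change powExp p c W b + edgeExp p c W i = _
        rw [powExp_add, powExp_single, add_comm]

variable {p c W}

/-- If `b` exceeds `a` at `i` and dominates `a` at every other index whose generator involves `v`,
then the exponent at `v` grows at least by that of generator `i`. -/
lemma edgeExp_add_powExp_le {a b : Fin n → ℕ} {i : Fin n} {v : σ} (hi : a i < b i)
    (h : ∀ j, j ≠ i → edgeExp p c W j v ≠ 0 → a j ≤ b j) :
    edgeExp p c W i v + powExp p c W a v ≤ powExp p c W b v := by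
  simp only [powExp_apply]
  rw [← Finset.add_sum_erase _ (fun j => a j * edgeExp p c W j v) (Finset.mem_univ i),
    ← Finset.add_sum_erase _ (fun j => b j * edgeExp p c W j v) (Finset.mem_univ i), ← add_assoc]
  refine add_le_add ?_ (Finset.sum_le_sum fun j hj => ?_)
  · calc edgeExp p c W i v + a i * edgeExp p c W i v = (a i + 1) * edgeExp p c W i v := by ring
      _ ≤ b i * edgeExp p c W i v := Nat.mul_le_mul_right _ hi
  · by_cases h0 : edgeExp p c W j v = 0
    · simp [h0]
    · exact Nat.mul_le_mul_right _ (h j (Finset.ne_of_mem_erase hj) h0)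

variable (p c W) in
open Classical in
/-- The generator attached to `i` of the colon ideal at `a`. -/
noncomputable def colonExp (a : Fin n → ℕ) (i : Fin n) : σ →₀ ℕ :=
  if ∃ j, i < j ∧ a j ≠ 0 ∧ (p j = p i ∨ c j = p i) then Finsupp.single (c i) (W i)
  else edgeExp p c W i

lemma colonExp_le_edgeExp (a : Fin n → ℕ) (i : Fin n) :
    colonExp p c W a i ≤ edgeExp p c W i := by
  unfold colonExp
  split_ifs
  · exact le_add_self
  · exact le_rfl

/-- Moving one unit from a later index to `i` in `a` changes the exponent by at most
`colonExp p c W a i`. -/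
lemma exists_powExp_le_colonExp (hW : ∀ i, 1 ≤ W i) {a : Fin n → ℕ} {i : Fin n}
    (hi : ∃ j, i < j ∧ a j ≠ 0) :
    ∃ b : Fin n → ℕ, ∑ j, b j = ∑ j, a j ∧ toLex a < toLex b ∧
      powExp p c W b ≤ powExp p c W a + colonExp p c W a i := by
  classical
  obtain ⟨j, hij, hj, hp⟩ : ∃ j, i < j ∧ a j ≠ 0 ∧
      edgeExp p c W i ≤ edgeExp p c W j + colonExp p c W a i := by
    by_cases h : ∃ j, i < j ∧ a j ≠ 0 ∧ (p j = p i ∨ c j = p i)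
    · obtain ⟨j, hij, hj, hpc⟩ := id h
      refine ⟨j, hij, hj, ?_⟩
      rw [colonExp, if_pos h, edgeExp]
      refine add_le_add_left ?_ _
      rw [Finsupp.single_le_iff, edgeExp_apply]
      have := hW j
      rcases hpc with hpc | hpc <;> (simp [hpc]; try omega)
    · obtain ⟨j, hij, hj⟩ := hi
      refine ⟨j, hij, hj, ?_⟩
      rw [colonExp, if_neg h]
      exact le_add_self
  have hle : Pi.single j 1 ≤ a := by
    intro l
    rcases eq_or_ne l j with rfl | hl
    · simpa using Nat.one_le_iff_ne_zero.2 hj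
    · simp [hl]
  obtain ⟨d, rfl⟩ := exists_add_of_le hle
  refine ⟨Pi.single i 1 + d, by simp [Finset.sum_add_distrib], ⟨i, fun l hl => ?_, ?_⟩, ?_⟩
  · have h1 : l ≠ i := hl.ne
    have h2 : l ≠ j := (hl.trans hij).ne
    simp [h1, h2]
  · simp [hij.ne]
  · simp only [powExp_add, powExp_single]
    calc _ ≤ (edgeExp p c W j + colonExp p c W _ i) + powExp p c W d := add_le_add_left hp _
      _ = _ := by abel

/-- If `b` comes before `a`, some `colonExp` is below the difference of exponents. -/
lemma exists_colonExp_add_powExp_le (hc : Function.Injective c)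
    (hpc : ∀ i j, p j = c i → j < i) {a b : Fin n → ℕ} (hs : ∑ j, b j = ∑ j, a j)
    (hab : toLex a < toLex b) :
    ∃ i, (∃ j, i < j ∧ a j ≠ 0) ∧ colonExp p c W a i ≤ powExp p c W b - powExp p c W a := by
  classical
  obtain ⟨i, heq, hlt⟩ := hab
  replace heq : ∀ j < i, a j = b j := heq
  replace hlt : a i < b i := hlt
  refine ⟨i, ?_, fun v => ?_⟩
  · by_contra! h
    refine hs.not_gt (Finset.sum_lt_sum (fun j _ => ?_) ⟨i, Finset.mem_univ i, hlt⟩)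
    rcases lt_trichotomy j i with hj | rfl | hj
    · exact (heq j hj).le
    · exact hlt.le
    · simp [h j hj]
  · by_cases hv : colonExp p c W a i v = 0
    · simp [hv]
    rw [Finsupp.tsub_apply]
    refine le_tsub_of_add_le_right ((add_le_add_left (colonExp_le_edgeExp a i v) _).trans
      (edgeExp_add_powExp_le hlt fun j hji hj => ?_))
    rcases lt_or_gt_of_ne hji with hlt' | hgt
    · exact (heq j hlt').le
    rw [edgeExp_apply] at hj
    have hj' : p j = v ∨ c j = v := by
      by_contra! h
      simp [h] at hj
    have hvc : v ≠ c i := by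
      rintro rfl
      rcases hj' with h | h
      · exact absurd (hpc i j h) hgt.asymm
      · exact hji (hc h)
    unfold colonExp at hv
    split_ifs at hv with hex
    · simp [hvc.symm] at hv
    · have hpv : p i = v := by
        by_contra h
        simp [edgeExp_apply, h, hvc.symm] at hv
      subst hpv
      by_contra! hba
      exact hex ⟨j, hgt, by omega, hj'⟩

end edgeExp

section

variable {k : Type u} [Field k] {σ : Type u}

lemma hasProjectiveDimensionLE_quotient_monIdeal_pow {n : ℕ} {p c : Fin n → σ} {W : Fin n → ℕ}
    (hc : Function.Injective c) (hpc : ∀ i j, p j = c i → j < i) (hW : ∀ i, 1 ≤ W i)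
    {t : ℕ} (ht : 1 ≤ t) :
    CategoryTheory.HasProjectiveDimensionLE (ModuleCat.of (MvPolynomial σ k)
      (MvPolynomial σ k ⧸ monIdeal k (Set.range (edgeExp p c W)) ^ t)) n := by
  classical
  rcases n with - | n
  · have : monIdeal k (Set.range (edgeExp p c W)) ^ t = ⊥ := by
      simp [monIdeal, Set.range_eq_empty, Nat.one_le_iff_ne_zero.1 ht]
    rw [this]
    exact hasProjectiveDimensionLE_quotient_bot _ _
  let T : Finset (Lex (Fin (n + 1) → ℕ)) :=
    (Finset.piAntidiag Finset.univ t).map toLex.toEmbedding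
  have hT : ∀ a, a ∈ T ↔ ∑ i, ofLex a i = t := by
    intro a
    change a ∈ (Finset.piAntidiag Finset.univ t).map toLex.toEmbedding ↔ _
    rw [Finset.mem_map_equiv, Finset.mem_piAntidiag]
    exact and_iff_left fun i _ => Finset.mem_univ i
  have hI : powExp p c W '' {a | ∑ i, a i = t} =
      (fun a => powExp p c W (ofLex a)) '' (T : Set (Lex (Fin (n + 1) → ℕ))) := by
    ext ξ
    constructor
    · rintro ⟨a, ha, rfl⟩
      exact ⟨toLex a, (hT _).2 ha, rfl⟩
    · rintro ⟨a, ha, rfl⟩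
      exact ⟨ofLex a, (hT _).1 ha, rfl⟩
  rw [monIdeal_range_edgeExp_pow, hI]
  refine hasProjectiveDimensionLE_quotient_monIdeal_image n _ T fun a ha => ?_
  refine ⟨(Finset.univ.filter fun i => ∃ j, i < j ∧ ofLex a j ≠ 0).image
    (colonExp p c W (ofLex a)), ?_, le_antisymm ?_ ?_⟩
  · refine Finset.card_image_le.trans (Nat.lt_succ_iff.1 ?_)
    refine (Finset.card_lt_univ_of_notMem (x := Fin.last n) ?_).trans_eq (Fintype.card_fin _)
    rw [Finset.mem_filter]
    rintro ⟨-, j, hj, -⟩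
    exact (Fin.le_last j).not_gt hj
  · refine monIdeal_mono ?_
    rintro _ ⟨b, ⟨hb, hab⟩, rfl⟩
    obtain ⟨i, hi, hle⟩ := exists_colonExp_add_powExp_le (W := W) hc hpc
      (((hT b).1 hb).trans ((hT a).1 ha).symm) hab
    exact ⟨_, Finset.mem_coe.2 (Finset.mem_image_of_mem _
      (Finset.mem_filter.2 ⟨Finset.mem_univ i, hi⟩)), hle⟩
  · refine monIdeal_mono fun ξ hξ => ?_
    obtain ⟨i, hi, rfl⟩ := Finset.mem_image.1 (Finset.mem_coe.1 hξ)
    obtain ⟨b, hs, hab, hle⟩ := exists_powExp_le_colonExp (p := p) (c := c) hW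
      (Finset.mem_filter.1 hi).2
    exact ⟨_, ⟨toLex b, ⟨(hT _).2 (hs.trans ((hT a).1 ha)), hab⟩, rfl⟩, tsub_le_iff_left.2 hle⟩

/-- A monomial outside `I ^ t` which every `x_{c i}` multiplies into `I ^ t`. -/
lemma exists_socle_exponent [Finite σ] {n : ℕ} {p c : Fin (n + 1) → σ} {W : Fin (n + 1) → ℕ}
    (hc : Function.Injective c) (hpc : ∀ i j, p j = c i → j < i) (hW : ∀ i, 1 ≤ W i)
    (hW2 : ∀ i j, p j = c i → 2 ≤ W i) {t : ℕ} (ht : 1 ≤ t) :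
    ∃ G : σ →₀ ℕ, (∀ a : Fin (n + 1) → ℕ, ∑ i, a i = t → ¬ powExp p c W a ≤ G) ∧
      ∀ i, ∃ a : Fin (n + 1) → ℕ, ∑ i, a i = t ∧
        powExp p c W a ≤ G + Finsupp.single (c i) 1 := by
  classical
  obtain ⟨s, rfl⟩ := exists_add_of_le ht
  let l := Fin.last n
  let g : σ → ℕ := Function.extend c (fun i => W i - 1 + if i = l then s * W l else 0)
    fun _ => 1 + s
  have hg : ∀ i, g (c i) = W i - 1 + if i = l then s * W l else 0 := fun i =>
    hc.extend_apply _ _ i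
  refine ⟨Finsupp.equivFunOnFinite.symm g, fun a ha hle => ?_, fun i => ?_⟩
  · have hmul : ∀ i, a i * W i ≤ W i - 1 + if i = l then s * W l else 0 := by
      intro i
      refine le_trans ?_ ((hle (c i)).trans_eq (hg i))
      rw [powExp_apply]
      refine le_trans (Nat.mul_le_mul_left _ ?_) (Finset.single_le_sum
        (f := fun j => a j * edgeExp p c W j (c i)) (fun _ _ => Nat.zero_le _) (Finset.mem_univ i))
      simp [edgeExp_apply]
    have h0 : ∀ i, i ≠ l → a i = 0 := by
      intro i hi
      have h1 := hmul i
      have h2 := hW i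
      rw [if_neg hi] at h1
      by_contra h3
      have := Nat.mul_le_mul_right (W i) (Nat.one_le_iff_ne_zero.2 h3)
      omega
    rw [Finset.sum_eq_single l (fun i _ hi => h0 i hi) (by simp)] at ha
    have h1 := hmul l
    have h2 := hW l
    rw [ha, if_pos rfl, add_mul] at h1
    omega
  · refine ⟨Pi.single i 1 + s • Pi.single l 1, ?_, fun v => ?_⟩
    · simp [Finset.sum_add_distrib, ← Finset.mul_sum]
    have hs : powExp p c W (s • Pi.single l 1) = s • edgeExp p c W l := by
      rw [← powExp_single, powExp, powExp, Finset.smul_sum]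
      exact Finset.sum_congr rfl fun j _ => by rw [Pi.smul_apply, smul_assoc]
    rw [powExp_add, powExp_single, hs]
    simp only [Finsupp.add_apply, Finsupp.smul_apply, smul_eq_mul, edgeExp_apply,
      Finsupp.equivFunOnFinite_symm_apply_apply, Finsupp.single_apply]
    by_cases hv : ∃ j, c j = v
    · obtain ⟨j, rfl⟩ := hv
      have hl : p l ≠ c j := fun h => (Fin.le_last j).not_gt (hpc j l h)
      have hi : p i = c j → 2 ≤ W j := hW2 j i
      have hij : p i = c j → i ≠ j := fun h => (hpc j i h).ne
      have h1 := hW j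
      rw [hg]
      simp only [hc.eq_iff, hl, if_false, zero_add, eq_comm (a := l)]
      by_cases hjl : j = l
      · subst hjl
        simp only [if_true]
        split_ifs with h2 h3 <;> first | omega | grind
      · simp only [hjl, if_false]
        split_ifs with h2 h3 <;> first | omega | grind
    · have hgv : g v = 1 + s := Function.extend_apply' _ _ _ hv
      simp only [not_exists] at hv
      rw [hgv]
      simp only [hv, if_false, add_zero]
      refine add_le_add (by split_ifs <;> omega) (mul_le_of_le_one_right (Nat.zero_le s) ?_)
      split_ifs <;> omega

lemma le_of_hasProjDimLE_quotient_monIdeal_pow [Finite σ] {n : ℕ} {p c : Fin n → σ}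
    {W : Fin n → ℕ}
    (hc : Function.Injective c) (hpc : ∀ i j, p j = c i → j < i) (hW : ∀ i, 1 ≤ W i)
    (hW2 : ∀ i j, p j = c i → 2 ≤ W i) {t : ℕ} (ht : 1 ≤ t) {j : ℕ}
    (h : HasProjDimLE (MvPolynomial σ k) j
      (MvPolynomial σ k ⧸ monIdeal k (Set.range (edgeExp p c W)) ^ t)) :
    n ≤ j := by
  rcases n with - | n
  · exact Nat.zero_le j
  obtain ⟨G, hG, hG'⟩ := exists_socle_exponent hc hpc hW hW2 ht
  have key := HasProjDimLE.length_le (isWeaklyRegular_map_X k (List.nodup_ofFn.2 hc)) h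
    (m := Submodule.Quotient.mk (monomial G 1)) ?_ ?_
  · simpa using key
  · rw [Ne, Submodule.Quotient.mk_eq_zero, monIdeal_range_edgeExp_pow, monomial_mem_monIdeal]
    rintro ⟨_, ⟨a, ha, rfl⟩, hle⟩
    exact hG a ha hle
  · intro r hr
    obtain ⟨v, hv, rfl⟩ := List.mem_map.1 hr
    obtain ⟨i, rfl⟩ := (List.mem_ofFn' _ _).1 hv
    rw [← Submodule.Quotient.mk_smul, Submodule.Quotient.mk_eq_zero, monIdeal_range_edgeExp_pow,
      smul_eq_mul, X, monomial_mul, one_mul, monomial_mem_monIdeal,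
      add_comm (Finsupp.single _ _)]
    obtain ⟨a, ha, hle⟩ := hG' i
    exact ⟨_, ⟨a, ha, rfl⟩, hle⟩

end

lemma projDim_quotient_monIdeal_pow {k : Type u} [Field k] {σ : Type u} [Finite σ] {n : ℕ}
    {p c : Fin n → σ} {W : Fin n → ℕ}
    (hc : Function.Injective c) (hpc : ∀ i j, p j = c i → j < i) (hW : ∀ i, 1 ≤ W i)
    (hW2 : ∀ i j, p j = c i → 2 ≤ W i) {t : ℕ} (ht : 1 ≤ t) :
    projDim (MvPolynomial σ k)
      (MvPolynomial σ k ⧸ monIdeal k (Set.range (edgeExp p c W)) ^ t) = n := by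
  refine le_antisymm (sInf_le ⟨n, rfl, ?_⟩) (le_sInf ?_)
  · exact HasProjDimLE.of_hasProjectiveDimensionLE _ _
      (hasProjectiveDimensionLE_quotient_monIdeal_pow hc hpc hW ht)
  · rintro _ ⟨j, rfl, hj⟩
    exact_mod_cast le_of_hasProjDimLE_quotient_monIdeal_pow hc hpc hW hW2 ht hj

/-- The arcs of an orientation of a forest can be enumerated so that an arc leaving the head of
another arc comes before it. -/
lemma exists_enumeration_of_isAcyclic {V : Type*} [Finite V] {E : Finset (V × V)}
    (hloop : ∀ e ∈ E, e.1 ≠ e.2) (hrev : ∀ e ∈ E, (e.2, e.1) ∉ E)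
    (hforest : (SimpleGraph.fromRel (fun u v : V => (u, v) ∈ E)).IsAcyclic) :
    ∃ e : Fin E.card ≃ E, ∀ i j, (e j).1.1 = (e i).1.2 → j < i := by
  classical
  let R : V → V → Prop := fun u v => (u, v) ∈ E
  have hirr : ∀ u v, R u v → ¬ Relation.ReflTransGen R v u := by
    intro u v huv hvu
    have hb := SimpleGraph.isAcyclic_iff_forall_adj_isBridge.1 hforest
      (v := u) (w := v) (by
        rw [SimpleGraph.fromRel_adj]
        exact ⟨hloop _ huv, Or.inl huv⟩)
    rw [SimpleGraph.isBridge_iff] at hb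
    refine hb (SimpleGraph.Reachable.symm ?_)
    suffices ∀ x, Relation.ReflTransGen R x u →
        ((SimpleGraph.fromRel fun u v => (u, v) ∈ E).deleteEdges {s(u, v)}).Reachable x u from
      this v hvu
    intro x hx
    induction hx using Relation.ReflTransGen.head_induction_on with
    | refl => exact SimpleGraph.Reachable.refl _
    | @head x y hxy _ ih =>
      by_cases hxu : x = u
      · rw [hxu]
      refine SimpleGraph.Reachable.trans (SimpleGraph.Adj.reachable ?_) ih
      rw [SimpleGraph.deleteEdges_adj, SimpleGraph.fromRel_adj]
      refine ⟨⟨hloop _ hxy, Or.inl hxy⟩, fun h => ?_⟩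
      rcases Sym2.eq_iff.1 (Set.mem_singleton_iff.1 h) with ⟨h1, -⟩ | ⟨rfl, rfl⟩
      · exact hxu h1
      · exact hrev _ huv hxy
  have hcycle : ∀ v, ¬ Relation.TransGen R v v := by
    intro v hv
    obtain ⟨y, hvy, hyv⟩ := Relation.TransGen.head'_iff.1 hv
    exact hirr v y hvy hyv
  let d : V → ℕ := fun v => {x | Relation.TransGen R v x}.ncard
  have hd : ∀ u v, R u v → d v < d u := by
    intro u v huv
    refine Set.ncard_lt_ncard ⟨fun x hx => Relation.TransGen.head huv hx, fun h => ?_⟩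
      (Set.toFinite _)
    exact hcycle v (h (Relation.TransGen.single huv))
  let g : Fin E.card ≃ E := E.equivFin.symm
  let f : Fin E.card → ℕ := fun i => d (g i).1.2
  refine ⟨(Tuple.sort f).trans g, fun i j hij => ?_⟩
  have hmono := Tuple.monotone_sort f
  by_contra! hle
  refine (hmono hle).not_gt ?_
  have := hd _ _ (g (Tuple.sort f j)).2
  change (g (Tuple.sort f j)).1.1 = (g (Tuple.sort f i)).1.2 at hij
  rw [hij] at this
  exact this

lemma edgeIdeal_eq_monIdeal (k : Type*) [Field k] {V : Type*} {E : Finset (V × V)} (w : V → ℕ)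
    {n : ℕ} (e : Fin n ≃ E) :
    edgeIdeal k E w = monIdeal k (Set.range (edgeExp (fun i => (e i).1.1) (fun i => (e i).1.2)
      (fun i => w (e i).1.2))) := by
  have hX : ∀ i, monomial (edgeExp (fun i => (e i).1.1) (fun i => (e i).1.2)
      (fun i => w (e i).1.2) i) (1 : k) = X (e i).1.1 * X (e i).1.2 ^ w (e i).1.2 := by
    intro i
    rw [edgeExp, X_pow_eq_monomial, X, monomial_mul, one_mul]
  rw [edgeIdeal, monIdeal, ← Set.range_comp]
  congr 1
  ext q
  constructor
  · rintro ⟨x, hx, rfl⟩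
    exact ⟨e.symm ⟨x, hx⟩, by simp [hX]⟩
  · rintro ⟨i, rfl⟩
    exact ⟨(e i).1, (e i).2, (hX i).symm⟩

/-- **Theorem (pd of powers of edge ideals of vertex-weighted rooted forests).**
Let `D = (V, E, w)` be a vertex-weighted rooted forest (the underlying graph is a
forest and every vertex has in-degree at most one, so all edges are oriented away
from the roots) with `w(x) ≥ 2` whenever `d(x) ≠ 1`.  Then for all `t ≥ 1`,
`pd (S/I(D)^t) = |E(D)|`. -/
theorem pd_pow_quotient_edgeIdeal_rootedForest
    (k : Type) [Field k] (V : Type) [Fintype V] [DecidableEq V]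
    (E : Finset (V × V)) (w : V → ℕ)
    (hw : ∀ v : V, 1 ≤ w v)
    (hloop : ∀ e ∈ E, e.1 ≠ e.2)
    (hrev : ∀ e ∈ E, (e.2, e.1) ∉ E)
    (hforest : (SimpleGraph.fromRel (fun u v : V => (u, v) ∈ E)).IsAcyclic)
    (hindeg : ∀ v : V, (E.filter (fun e => e.2 = v)).card ≤ 1)
    (hw2 : ∀ x : V, (E.filter (fun e => e.1 = x ∨ e.2 = x)).card ≠ 1 → 2 ≤ w x)
    (t : ℕ) (ht : 1 ≤ t) :
    projDim (MvPolynomial V k) (MvPolynomial V k ⧸ (edgeIdeal k E w) ^ t) = (E.card : ℕ∞) := by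
  obtain ⟨e, he⟩ := exists_enumeration_of_isAcyclic hloop hrev hforest
  rw [edgeIdeal_eq_monIdeal k w e]
  refine projDim_quotient_monIdeal_pow (fun i j hij => ?_) he (fun i => hw _)
    (fun i j hij => hw2 _ fun h1 => ?_) ht
  · refine e.injective (Subtype.ext (Finset.card_le_one.1 (hindeg (e i).1.2) _ ?_ _ ?_))
    · exact Finset.mem_filter.2 ⟨(e i).2, rfl⟩
    · exact Finset.mem_filter.2 ⟨(e j).2, hij.symm⟩
  · refine (he i j hij).ne (e.injective (Subtype.ext (Finset.card_le_one.1 h1.le _ ?_ _ ?_)))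
    · exact Finset.mem_filter.2 ⟨(e j).2, Or.inl hij⟩
    · exact Finset.mem_filter.2 ⟨(e i).2, Or.inr rfl⟩
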